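/- Let (W,S) be a Coxeter system with length function ℓ, and let W' ≤ W be a reflection subgroup, i.e. a subgroup generated by a set of reflections of W. Let s ∈ S be a simple reflection with s ∉ W', and let v ∈ W satisfy ℓ(vs) = ℓ(v) + 1. Note that sW's is again a reflection subgroup of W, and (vs)W' = (v·(sW's))·s. If u is the element of minimal length in the coset v·(sW's), then u·s is the element of minimal length in the coset (vs)W'. -/

import Mathlib

namespace CoxeterSystem

variable {B W : Type*} [Group W] {M : CoxeterMatrix B} (cs : CoxeterSystem M W)

open Classical in
/-- The involution `(t, ε) ↦ (s t s, ε + [t = s])` of `W × ZMod 2` attached to the simple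
reflection `s = cs.simple i`. -/
noncomputable def signedConj (i : B) : Equiv.Perm (W × ZMod 2) :=
  Function.Involutive.toPerm
    (fun x => (cs.simple i * x.1 * cs.simple i, x.2 + if x.1 = cs.simple i then 1 else 0)) (by
      rintro ⟨t, ε⟩
      have h : cs.simple i * t * cs.simple i = cs.simple i ↔ t = cs.simple i := by
        constructor
        · intro h
          simpa [mul_assoc] using congrArg (fun x => cs.simple i * x * cs.simple i) h
        · rintro rfl
          simp
      have h2 : (1 : ZMod 2) + 1 = 0 := by decide
      ext
      · simp [mul_assoc]
      · simp only [h]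
        split_ifs <;> simp [add_assoc, h2])

open Classical in
theorem signedConj_apply (i : B) (x : W × ZMod 2) :
    cs.signedConj i x =
      (cs.simple i * x.1 * cs.simple i, x.2 + if x.1 = cs.simple i then 1 else 0) :=
  rfl

open Classical in
theorem signedConj_mul_pow_apply (i j : B) (n : ℕ) (x : W × ZMod 2) :
    ((cs.signedConj i * cs.signedConj j) ^ n) x =
      ((cs.simple i * cs.simple j) ^ n * x.1 * ((cs.simple i * cs.simple j) ^ n)⁻¹,
        x.2 + ∑ k ∈ Finset.range (2 * n),
          if (cs.simple i * cs.simple j) ^ k * x.1 = cs.simple j then 1 else 0) := by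
  set p := cs.simple i * cs.simple j with hp
  have hinv : p⁻¹ = cs.simple j * cs.simple i := by simp [hp]
  have hswap : ∀ k : ℕ, cs.simple j * p ^ k = (p ^ k)⁻¹ * cs.simple j := by
    intro k
    have h : SemiconjBy (cs.simple j) p p⁻¹ := by
      simp [SemiconjBy, hp, mul_assoc]
    simpa using (h.pow_right k).eq
  induction n with
  | zero => simp
  | succ n ih =>
    have h1 : p ^ n * x.1 * (p ^ n)⁻¹ = cs.simple j ↔ p ^ (2 * n) * x.1 = cs.simple j := by
      rw [mul_inv_eq_iff_eq_mul, hswap, eq_inv_mul_iff_mul_eq, ← mul_assoc, ← pow_add, two_mul]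
    have h2 : cs.simple j * (p ^ n * x.1 * (p ^ n)⁻¹) * cs.simple j = cs.simple i ↔
        p ^ (2 * n + 1) * x.1 = cs.simple j := by
      have : cs.simple j * (p ^ n * x.1 * (p ^ n)⁻¹) * cs.simple j = cs.simple i ↔
          p * (p ^ n * x.1 * (p ^ n)⁻¹) = cs.simple j := by
        rw [← mul_right_inj (cs.simple i), ← mul_left_inj (cs.simple j)]
        simp [hp, mul_assoc]
      rw [this, ← mul_assoc, mul_inv_eq_iff_eq_mul, hswap, eq_inv_mul_iff_mul_eq, two_mul,
        add_assoc, pow_add p n, pow_succ']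
      simp only [mul_assoc]
    rw [pow_succ', Equiv.Perm.mul_apply, ih, Equiv.Perm.mul_apply, signedConj_apply,
      signedConj_apply]
    simp only [h1, h2]
    rw [show 2 * (n + 1) = 2 * n + 1 + 1 by ring, Finset.sum_range_succ, Finset.sum_range_succ]
    ext
    · simp only [pow_succ' p n, mul_inv_rev, hinv]
      simp only [hp, mul_assoc]
    · simp only [add_assoc]

theorem isLiftable_signedConj : M.IsLiftable cs.signedConj := by
  classical
  intro i j
  ext1 x
  rw [signedConj_mul_pow_apply, cs.simple_mul_simple_pow, two_mul, Finset.sum_range_add]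
  have h : ∀ a : ZMod 2, a + a = 0 := by decide
  simp [pow_add, h]

/-- The action of `W` on `W × ZMod 2` extending `signedConj`. -/
noncomputable def signedConjHom : W →* Equiv.Perm (W × ZMod 2) :=
  cs.lift ⟨cs.signedConj, cs.isLiftable_signedConj⟩

theorem signedConjHom_simple (i : B) : cs.signedConjHom (cs.simple i) = cs.signedConj i :=
  cs.lift_apply_simple cs.isLiftable_signedConj i

/-- The reflection cocycle: the parity of the number of occurrences of `t` in the right inversion
sequence of any word for `w`. -/
noncomputable def reflCocycle (w t : W) : ZMod 2 := (cs.signedConjHom w (t, 0)).2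

theorem signedConjHom_apply (w : W) (x : W × ZMod 2) :
    cs.signedConjHom w x = (w * x.1 * w⁻¹, x.2 + cs.reflCocycle w x.1) := by
  unfold reflCocycle
  induction w using cs.simple_induction_left generalizing x with
  | one => simp
  | mul_simple_left w i ih =>
    simp only [map_mul, Equiv.Perm.mul_apply, signedConjHom_simple]
    rw [ih x, ih (x.1, 0)]
    simp [signedConj_apply, mul_assoc, add_assoc]

@[simp]
theorem reflCocycle_one (t : W) : cs.reflCocycle 1 t = 0 := by
  simp [reflCocycle]

theorem reflCocycle_mul (x y t : W) :
    cs.reflCocycle (x * y) t = cs.reflCocycle y t + cs.reflCocycle x (y * t * y⁻¹) := by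
  conv_lhs => rw [reflCocycle, map_mul, Equiv.Perm.mul_apply]
  simp [signedConjHom_apply]

open Classical in
theorem reflCocycle_simple (i : B) (t : W) :
    cs.reflCocycle (cs.simple i) t = if t = cs.simple i then 1 else 0 := by
  simp [reflCocycle, signedConjHom_simple, signedConj_apply]

open Classical in
/-- The canonical generators of a subgroup `H`: the involutions `r ∈ H` whose only inversion
in `H` is `r` itself. -/
def canonicalGenerators (H : Subgroup W) : Set W :=
  {r | r ∈ H ∧ r * r = 1 ∧ ∀ t ∈ H, cs.reflCocycle r t = if t = r then 1 else 0}

variable {cs} in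
theorem simple_mem_canonicalGenerators {H : Subgroup W} {i : B} (h : cs.simple i ∈ H) :
    cs.simple i ∈ cs.canonicalGenerators H :=
  ⟨h, cs.simple_mul_simple_self i, fun t _ => cs.reflCocycle_simple i t⟩

theorem closure_canonicalGenerators_le (H : Subgroup W) :
    Subgroup.closure (cs.canonicalGenerators H) ≤ H :=
  (Subgroup.closure_le H).2 fun _ hr => hr.1

theorem exists_list_of_reflCocycle_ne_zero {H : Subgroup W} {l : List W}
    (hl : ∀ r ∈ l, r ∈ cs.canonicalGenerators H) {t : W} (ht : t ∈ H)
    (h : cs.reflCocycle l.prod t ≠ 0) :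
    ∃ l' : List W, (∀ r ∈ l', r ∈ l) ∧ l'.length < l.length ∧ l'.prod = l.prod * t := by
  induction l with
  | nil => simp at h
  | cons r l ih =>
    obtain ⟨hr, hl⟩ := List.forall_mem_cons.1 hl
    by_cases h0 : cs.reflCocycle l.prod t = 0
    · have hlH : l.prod ∈ H := list_prod_mem fun x hx => (hl x hx).1
      rw [List.prod_cons, reflCocycle_mul, h0, zero_add,
        hr.2.2 _ (H.mul_mem (H.mul_mem hlH ht) (H.inv_mem hlH))] at h
      have h1 : l.prod * t = r * l.prod := by
        rw [← mul_inv_eq_iff_eq_mul]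
        simpa using h
      refine ⟨l, fun x hx => List.mem_cons_of_mem _ hx, by simp, ?_⟩
      rw [List.prod_cons, mul_assoc, h1, ← mul_assoc, hr.2.1, one_mul]
    · obtain ⟨l', hmem, hlen, hprod⟩ := ih hl h0
      refine ⟨r :: l', ?_, by simpa using hlen, by simp [hprod, mul_assoc]⟩
      intro x hx
      rcases List.mem_cons.1 hx with rfl | hx
      · simp
      · exact List.mem_cons_of_mem _ (hmem x hx)

theorem prod_eq_one_of_reflCocycle_eq_zero {H : Subgroup W} (l : List W)
    (hl : ∀ r ∈ l, r ∈ cs.canonicalGenerators H)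
    (h : ∀ t ∈ H, cs.reflCocycle l.prod t = 0) : l.prod = 1 := by
  induction hn : l.length using Nat.strong_induction_on generalizing l with
  | _ n ih =>
    subst hn
    cases l with
    | nil => rfl
    | cons r l =>
      obtain ⟨hr, hl'⟩ := List.forall_mem_cons.1 hl
      have hlH : l.prod ∈ H := list_prod_mem fun x hx => (hl' x hx).1
      have ht : l.prod⁻¹ * r * l.prod ∈ H :=
        H.mul_mem (H.mul_mem (H.inv_mem hlH) hr.1) hlH
      have hne : cs.reflCocycle l.prod (l.prod⁻¹ * r * l.prod) ≠ 0 := by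
        intro h0
        have h1 := h _ ht
        rw [List.prod_cons, reflCocycle_mul, h0,
          show l.prod * (l.prod⁻¹ * r * l.prod) * l.prod⁻¹ = r by group, hr.2.2 r hr.1] at h1
        simp at h1
      obtain ⟨l', hmem, hlen, hprod⟩ := cs.exists_list_of_reflCocycle_ne_zero hl' ht hne
      have heq : l'.prod = (r :: l).prod := by
        rw [hprod, List.prod_cons]
        group
      rw [← heq] at h ⊢
      exact ih _ (by simp; lia) l' (fun x hx => hl' x (hmem x hx)) h rfl

theorem length_mul_lt_of_reflCocycle_ne_zero {w t : W} (h : cs.reflCocycle w t ≠ 0) :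
    cs.length (w * t) < cs.length w := by
  obtain ⟨ω, hω, rfl⟩ := cs.exists_isReduced w
  have hsimple : ∀ r ∈ ω.map cs.simple, r ∈ cs.canonicalGenerators ⊤ := by
    intro r hr
    obtain ⟨i, -, rfl⟩ := List.mem_map.1 hr
    exact simple_mem_canonicalGenerators (Subgroup.mem_top _)
  obtain ⟨l, hmem, hlen, hprod⟩ :=
    cs.exists_list_of_reflCocycle_ne_zero hsimple (Subgroup.mem_top t) h
  obtain ⟨ω', rfl⟩ : l ∈ Set.range (List.map cs.simple) := by
    rw [Set.range_list_map]
    intro r hr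
    obtain ⟨i, -, rfl⟩ := List.mem_map.1 (hmem r hr)
    exact ⟨i, rfl⟩
  rw [hω.eq]
  change cs.length ((ω.map cs.simple).prod * t) < _
  rw [← hprod]
  exact (cs.length_wordProd_le ω').trans_lt (by simpa using hlen)

theorem conj_mem_canonicalGenerators {H : Subgroup W} {i : B} (hi : cs.simple i ∉ H) {r : W}
    (hr : r ∈ cs.canonicalGenerators (H.comap (MulAut.conj (cs.simple i)).toMonoidHom)) :
    cs.simple i * r * cs.simple i ∈ cs.canonicalGenerators H := by
  obtain ⟨hrH, hrr, hcoc⟩ := hr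
  have hrH : cs.simple i * r * cs.simple i ∈ H := by simpa using hrH
  refine ⟨hrH, ?_, fun t ht => ?_⟩
  · simp [mul_assoc, ← mul_assoc r r, hrr]
  · have hts : t ≠ cs.simple i := fun h => hi (h ▸ ht)
    have hconj : r * (cs.simple i * t * cs.simple i) * r⁻¹ ≠ cs.simple i := by
      intro h
      apply hi
      have := H.mul_mem (H.mul_mem hrH ht) (H.inv_mem hrH)
      have h' : cs.simple i * (r * (cs.simple i * t * cs.simple i) * r⁻¹) * cs.simple i ∈ H := by
        simpa [mul_assoc] using this
      simpa [h] using h'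
    have hiff : cs.simple i * t * cs.simple i = r ↔ t = cs.simple i * r * cs.simple i := by
      constructor
      · rintro rfl
        simp [mul_assoc]
      · rintro rfl
        simp [mul_assoc]
    have hconj_eq : r * cs.simple i * t * (r * cs.simple i)⁻¹ =
        r * (cs.simple i * t * cs.simple i) * r⁻¹ := by
      simp [mul_assoc]
    rw [mul_assoc, reflCocycle_mul, reflCocycle_mul, reflCocycle_simple, if_neg hts, hconj_eq,
      reflCocycle_simple, if_neg hconj, inv_simple, zero_add, add_zero,
      hcoc _ (by simpa [mul_assoc] using ht)]
    classical exact if_congr (by rw [hiff, mul_assoc]) rfl rfl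

variable {cs} in
theorem IsReflection.mem_closure_canonicalGenerators {t : W} (ht : cs.IsReflection t)
    {H : Subgroup W} (htH : t ∈ H) : t ∈ Subgroup.closure (cs.canonicalGenerators H) := by
  obtain ⟨w, i, rfl⟩ := ht
  induction w using cs.simple_induction_left generalizing H with
  | one =>
    simp only [one_mul, inv_one, mul_one] at htH ⊢
    exact Subgroup.subset_closure (simple_mem_canonicalGenerators htH)
  | mul_simple_left w j ih =>
    have heq : cs.simple j * w * cs.simple i * (cs.simple j * w)⁻¹ =
        cs.simple j * (w * cs.simple i * w⁻¹) * cs.simple j := by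
      simp [mul_assoc]
    rw [heq] at htH ⊢
    by_cases hj : cs.simple j ∈ H
    · have hj' := Subgroup.subset_closure (simple_mem_canonicalGenerators hj)
      refine mul_mem (mul_mem hj' (ih ?_)) hj'
      simpa [mul_assoc] using H.mul_mem (H.mul_mem hj htH) hj
    · have hle : Subgroup.closure
            (cs.canonicalGenerators (H.comap (MulAut.conj (cs.simple j)).toMonoidHom)) ≤
          (Subgroup.closure (cs.canonicalGenerators H)).comap
            (MulAut.conj (cs.simple j)).toMonoidHom := by
        refine (Subgroup.closure_le _).2 fun r hr => ?_
        simpa using Subgroup.subset_closure (cs.conj_mem_canonicalGenerators hj hr)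
      simpa using hle (ih (by simpa using htH))

theorem closure_canonicalGenerators {T : Set W} (hT : ∀ t ∈ T, cs.IsReflection t) :
    Subgroup.closure (cs.canonicalGenerators (Subgroup.closure T)) = Subgroup.closure T :=
  le_antisymm (cs.closure_canonicalGenerators_le _) <| (Subgroup.closure_le _).2 fun t ht =>
    (hT t ht).mem_closure_canonicalGenerators (Subgroup.subset_closure ht)

theorem eq_one_of_reflCocycle_eq_zero {T : Set W} (hT : ∀ t ∈ T, cs.IsReflection t) {w : W}
    (hw : w ∈ Subgroup.closure T) (h : ∀ t ∈ Subgroup.closure T, cs.reflCocycle w t = 0) :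
    w = 1 := by
  rw [← cs.closure_canonicalGenerators hT, ← Subgroup.mem_toSubmonoid,
    Subgroup.closure_toSubmonoid] at hw
  obtain ⟨l, hl, rfl⟩ := Submonoid.exists_list_of_mem_closure hw
  refine cs.prod_eq_one_of_reflCocycle_eq_zero l (fun r hr => ?_) h
  rcases hl r hr with hr | hr
  · exact hr
  · have : r⁻¹⁻¹ = r⁻¹ := inv_eq_of_mul_eq_one_left hr.2.1
    rw [inv_inv] at this
    rwa [this]

/-- An element without inversions in a reflection subgroup has minimal length in its coset. -/
theorem length_le_length_mul_of_reflCocycle_eq_zero {T : Set W}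
    (hT : ∀ t ∈ T, cs.IsReflection t) {y : W}
    (hy : ∀ t ∈ Subgroup.closure T, cs.reflCocycle y t = 0) {w : W}
    (hw : w ∈ Subgroup.closure T) : cs.length y ≤ cs.length (y * w) := by
  set H := Subgroup.closure T
  obtain ⟨a, haH, hmin⟩ := exists_minimalFor_of_wellFoundedLT (· ∈ H)
    (fun a => cs.length (y * a)) ⟨1, H.one_mem⟩
  have hle : ∀ b ∈ H, cs.length (y * a) ≤ cs.length (y * b) := fun b hb =>
    (le_total _ _).elim id (hmin hb)
  have hya : ∀ t ∈ H, cs.reflCocycle (y * a) t = 0 := by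
    intro t ht
    by_contra h
    have hlt := cs.length_mul_lt_of_reflCocycle_ne_zero h
    rw [mul_assoc] at hlt
    exact hlt.not_ge (hle _ (H.mul_mem haH ht))
  have ha : a = 1 := by
    refine cs.eq_one_of_reflCocycle_eq_zero hT haH fun t ht => ?_
    have h := hya t ht
    rwa [reflCocycle_mul, hy _ (H.mul_mem (H.mul_mem haH ht) (H.inv_mem haH)), add_zero] at h
  simpa [ha] using hle w hw

end CoxeterSystem


/-- Let `W'` be a reflection subgroup of a Coxeter group, `s` a simple reflection
not lying in `W'`, and `v` an element with `ℓ(v * s) = ℓ(v) + 1`.  If `u` is the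
minimal-length element of the coset `v • (s W' s)` (where `s W' s` is the conjugate
reflection subgroup), then `u * s` is the minimal-length element of the coset
`(v * s) • W'`. -/
theorem minimal_coset_rep_of_mul_simple
    {B W : Type*} [Group W] {M : CoxeterMatrix B} (cs : CoxeterSystem M W)
    (W' : Subgroup W)
    (hrefl : ∃ T : Set W, (∀ t ∈ T, cs.IsReflection t) ∧ W' = Subgroup.closure T)
    (i : B) (s : W) (hs : s = cs.simple i) (hsW' : s ∉ W')
    (v : W) (hlen : cs.length (v * s) = cs.length v + 1)
    (u : W)
    (hu_mem : v⁻¹ * u ∈ Subgroup.map ((MulAut.conj s).toMonoidHom) W')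
    (hu_min : ∀ x : W, v⁻¹ * x ∈ Subgroup.map ((MulAut.conj s).toMonoidHom) W' →
      cs.length u ≤ cs.length x) :
    (v * s)⁻¹ * (u * s) ∈ W' ∧
      ∀ x : W, (v * s)⁻¹ * x ∈ W' → cs.length (u * s) ≤ cs.length x := by
  obtain ⟨T, hT, rfl⟩ := hrefl
  subst hs
  have hmap : ∀ x : W, x ∈ Subgroup.map ((MulAut.conj (cs.simple i)).toMonoidHom)
      (Subgroup.closure T) ↔ cs.simple i * x * cs.simple i ∈ Subgroup.closure T := by
    intro x
    constructor
    · rintro ⟨y, hy, rfl⟩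
      simpa [mul_assoc] using hy
    · intro hx
      exact ⟨_, hx, by simp [mul_assoc]⟩
  simp only [hmap] at hu_mem hu_min
  have hmem : (v * cs.simple i)⁻¹ * (u * cs.simple i) ∈ Subgroup.closure T := by
    simpa [mul_assoc] using hu_mem
  have hzero : ∀ t ∈ Subgroup.closure T, cs.reflCocycle (u * cs.simple i) t = 0 := by
    intro t ht
    have hts : t ≠ cs.simple i := fun h => hsW' (h ▸ ht)
    rw [cs.reflCocycle_mul, cs.reflCocycle_simple, if_neg hts, zero_add]
    by_contra h
    refine (cs.length_mul_lt_of_reflCocycle_ne_zero h).not_ge (hu_min _ ?_)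
    simpa [mul_assoc] using mul_mem hu_mem ht
  refine ⟨hmem, fun x hx => ?_⟩
  have hw := mul_mem (inv_mem hmem) hx
  simpa [mul_assoc] using cs.length_le_length_mul_of_reflCocycle_eq_zero hT hzero hw
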